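/- arXiv:0908.2442 — 3 statements merged into one kernel-verified Lean document; each statement's English description precedes it below -/
import Mathlib

section
/- Let k, k' ≥ 3 be integers, and let d, d' be integers with 1 ≤ d ≤ ⌈k/2⌉ − 1, gcd(d, k) = 1, 1 ≤ d' ≤ ⌈k'/2⌉ − 1, and gcd(d', k') = 1. Let c, c' ∈ ℂ and z, z' ∈ ℂ with z ≠ 0, z' ≠ 0, and set v_m = c + z·exp(2πi·m/k) and w_m = c' + z'·exp(2πi·m/k'). Suppose for some integers j, j' the apexes coincide, v_j = w_{j'}, and the base vertex pairs coincide as sets, {v_{j−d}, v_{j+d}} = {w_{j'−d'}, w_{j'+d'}}. Then k = k', d = d', and the two regular polygons have the same vertex set: {v_m : 0 ≤ m < k} = {w_m : 0 ≤ m < k'}. -/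
/-- The `m`-th vertex of the regular `k`-gon with center `c` and "first radius
vector" `z`: the point `c + z·exp(2πi·m/k)`. -/
noncomputable def vtx (k : ℕ) (c z : ℂ) (m : ℤ) : ℂ :=
  c + z * Complex.exp (2 * Real.pi * Complex.I * m / k)

lemma vtx_shift (k : ℕ) (c z : ℂ) (j m : ℤ) :
    vtx k c z (j + m) = vtx k c (z * Complex.exp (2 * Real.pi * Complex.I * j / k)) m := by
  unfold vtx
  rw [mul_assoc z, ← Complex.exp_add]
  congr 3
  push_cast
  ring

lemma vtx_period (k : ℕ) (hk : k ≠ 0) (c z : ℂ) (m q : ℤ) :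
    vtx k c z (m + k * q) = vtx k c z m := by
  unfold vtx
  have hk' : (k : ℂ) ≠ 0 := by exact_mod_cast hk
  have : (2 * Real.pi * Complex.I * ((m + k * q : ℤ) : ℂ) / k : ℂ)
      = 2 * Real.pi * Complex.I * m / k + q * (2 * Real.pi * Complex.I) := by
    push_cast
    field_simp
  rw [this, Complex.exp_add, Complex.exp_int_mul_two_pi_mul_I, mul_one]

lemma vtx_image (k : ℕ) (hk : k ≠ 0) (c z : ℂ) :
    vtx k c z '' Set.Ico (0 : ℤ) (k : ℤ) = Set.range (vtx k c z) := by
  apply Set.Subset.antisymm (Set.image_subset_range _ _)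
  rintro _ ⟨m, rfl⟩
  refine ⟨m % k, ⟨Int.emod_nonneg _ (by exact_mod_cast hk), Int.emod_lt_of_pos _ (by omega)⟩, ?_⟩
  rw [← vtx_period k hk c z (m % k) (m / k), Int.emod_add_mul_ediv]

lemma two_mul_lt_of_ceil (k d : ℕ) (hd1 : 1 ≤ d) (hd2 : d ≤ ⌈(k : ℚ) / 2⌉₊ - 1) : 2 * d < k := by
  have h : d < ⌈(k : ℚ) / 2⌉₊ := by omega
  rw [Nat.lt_ceil, lt_div_iff₀ (by norm_num)] at h
  have h2 : d * 2 < k := by exact_mod_cast h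
  omega

lemma angle_bd (k d : ℕ) (hd1 : 1 ≤ d) (h : 2 * d < k) :
    0 < 2 * Real.pi * d / k ∧ 2 * Real.pi * d / k < Real.pi := by
  have hk : (0 : ℝ) < k := by exact_mod_cast (by omega : 0 < k)
  have hd : (0 : ℝ) < d := by exact_mod_cast hd1
  have h' : (2 * d : ℝ) < k := by exact_mod_cast h
  have := Real.pi_pos
  refine ⟨by positivity, ?_⟩
  rw [div_lt_iff₀ hk]
  nlinarith

lemma vtx_pos (k : ℕ) (c a : ℂ) (d : ℕ) :
    vtx k c a d = c + a * Complex.exp ((2 * Real.pi * d / k : ℝ) * Complex.I) := by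
  unfold vtx
  congr 3
  push_cast
  ring

lemma vtx_neg (k : ℕ) (c a : ℂ) (d : ℕ) :
    vtx k c a (-d) = c + a * (Complex.exp ((2 * Real.pi * d / k : ℝ) * Complex.I))⁻¹ := by
  unfold vtx
  rw [← Complex.exp_neg]
  congr 3
  push_cast
  ring

lemma vtx_zero (k : ℕ) (c a : ℂ) : vtx k c a 0 = c + a := by
  simp [vtx]

lemma tri_key (c c' a a' w w' : ℂ) (hw : w ≠ 0) (hw' : w' ≠ 0) (ha : a' ≠ 0) (hw1 : w' ≠ 1)
    (h0 : c + a = c' + a') (h1 : c + a * w⁻¹ = c' + a' * w'⁻¹) (h2 : c + a * w = c' + a' * w') :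
    w = w' := by
  have e1 : a * (1 - w) * w' = a' * (1 - w') * w := by
    have h : a * (w⁻¹ - 1) = a' * (w'⁻¹ - 1) := by linear_combination h1 - h0
    field_simp at h
    linear_combination h
  have e2 : a * (1 - w) = a' * (1 - w') := by linear_combination h0 - h2
  rw [e2] at e1
  exact (mul_left_cancel₀ (mul_ne_zero ha (sub_ne_zero.2 hw1.symm)) e1).symm

/-- If a special triangle (apex `v_j`, base `{v_{j-d}, v_{j+d}}`, with
`1 ≤ d ≤ ⌈k/2⌉ - 1` and `gcd(d,k) = 1`) of a regular `k`-gon coincides with a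
special triangle of a regular `k'`-gon, then `k = k'`, `d = d'`, and the two
polygons have the same vertex set. -/
theorem stmt_3 (k k' : ℕ) (hk : 3 ≤ k) (hk' : 3 ≤ k')
    (d d' : ℕ) (hd1 : 1 ≤ d) (hd2 : d ≤ ⌈(k : ℚ) / 2⌉₊ - 1) (hdk : Nat.gcd d k = 1)
    (hd'1 : 1 ≤ d') (hd'2 : d' ≤ ⌈(k' : ℚ) / 2⌉₊ - 1) (hd'k : Nat.gcd d' k' = 1)
    (c c' z z' : ℂ) (hz : z ≠ 0) (hz' : z' ≠ 0) (j j' : ℤ)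
    (happex : vtx k c z j = vtx k' c' z' j')
    (hbase : ({vtx k c z (j - d), vtx k c z (j + d)} : Set ℂ)
              = ({vtx k' c' z' (j' - d'), vtx k' c' z' (j' + d')} : Set ℂ)) :
    k = k' ∧ d = d' ∧
      vtx k c z '' Set.Ico (0 : ℤ) (k : ℤ) = vtx k' c' z' '' Set.Ico (0 : ℤ) (k' : ℤ) := by
  have hb := two_mul_lt_of_ceil k d hd1 hd2
  have hb' := two_mul_lt_of_ceil k' d' hd'1 hd'2
  obtain ⟨t0, t1⟩ := angle_bd k d hd1 hb
  obtain ⟨t0', t1'⟩ := angle_bd k' d' hd'1 hb'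
  have hj : vtx k c z j = vtx k c z (j + 0) := by rw [add_zero]
  have hj' : vtx k' c' z' j' = vtx k' c' z' (j' + 0) := by rw [add_zero]
  rw [hj, hj', vtx_shift, vtx_shift, vtx_zero, vtx_zero] at happex
  rw [sub_eq_add_neg, sub_eq_add_neg, vtx_shift, vtx_shift, vtx_shift, vtx_shift,
    vtx_pos, vtx_pos, vtx_neg, vtx_neg] at hbase
  have sh : ∀ m, vtx k c z m
      = vtx k c (z * Complex.exp (2 * Real.pi * Complex.I * j / k)) (m - j) := by
    intro m
    rw [← vtx_shift]; congr 1; ring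
  have sh' : ∀ m, vtx k' c' z' m
      = vtx k' c' (z' * Complex.exp (2 * Real.pi * Complex.I * j' / k')) (m - j') := by
    intro m
    rw [← vtx_shift]; congr 1; ring
  have ha : z * Complex.exp (2 * Real.pi * Complex.I * j / k) ≠ 0 :=
    mul_ne_zero hz (Complex.exp_ne_zero _)
  have ha' : z' * Complex.exp (2 * Real.pi * Complex.I * j' / k') ≠ 0 :=
    mul_ne_zero hz' (Complex.exp_ne_zero _)
  generalize z * Complex.exp (2 * Real.pi * Complex.I * j / k) = a at *
  generalize z' * Complex.exp (2 * Real.pi * Complex.I * j' / k') = a' at *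
  have im1 : 0 < (Complex.exp ((2 * Real.pi * d / k : ℝ) * Complex.I)).im := by
    rw [Complex.exp_ofReal_mul_I_im]
    exact Real.sin_pos_of_pos_of_lt_pi t0 t1
  have im2 : 0 < (Complex.exp ((2 * Real.pi * d' / k' : ℝ) * Complex.I)).im := by
    rw [Complex.exp_ofReal_mul_I_im]
    exact Real.sin_pos_of_pos_of_lt_pi t0' t1'
  have inj : Complex.exp ((2 * Real.pi * d / k : ℝ) * Complex.I)
      = Complex.exp ((2 * Real.pi * d' / k' : ℝ) * Complex.I) →
      2 * Real.pi * d / k = 2 * Real.pi * d' / k' := by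
    intro h
    have h := congrArg Complex.re h
    rw [Complex.exp_ofReal_mul_I_re, Complex.exp_ofReal_mul_I_re] at h
    exact Real.injOn_cos ⟨t0.le, t1.le⟩ ⟨t0'.le, t1'.le⟩ h
  have n1 := Complex.exp_ne_zero ((2 * Real.pi * d / k : ℝ) * Complex.I)
  have n2 := Complex.exp_ne_zero ((2 * Real.pi * d' / k' : ℝ) * Complex.I)
  generalize Complex.exp ((2 * Real.pi * d / k : ℝ) * Complex.I) = w at *
  generalize Complex.exp ((2 * Real.pi * d' / k' : ℝ) * Complex.I) = w' at *
  have w1 : w' ≠ 1 := by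
    rintro rfl
    simp at im2
  rw [Set.pair_eq_pair_iff] at hbase
  rcases hbase with ⟨h1, h2⟩ | ⟨h1, h2⟩
  · have hw := tri_key c c' a a' w w' n1 n2 ha' w1 happex h1 h2
    have ht := inj hw
    have hkR : (k : ℝ) ≠ 0 := by
      have : k ≠ 0 := by omega
      exact_mod_cast this
    have hkR' : (k' : ℝ) ≠ 0 := by
      have : k' ≠ 0 := by omega
      exact_mod_cast this
    have hpi := Real.pi_ne_zero
    have hx : (d : ℝ) * k' = d' * k := by
      rw [div_eq_div_iff hkR hkR'] at ht
      have h3 : (2 * Real.pi) * ((d : ℝ) * k') = (2 * Real.pi) * (d' * k) := by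
        linear_combination ht
      exact mul_left_cancel₀ (by positivity) h3
    have hx : d * k' = d' * k := by exact_mod_cast hx
    have dd : d = d' := by
      apply Nat.dvd_antisymm
      · exact (Nat.Coprime.dvd_of_dvd_mul_right hdk (hx ▸ Dvd.intro _ rfl))
      · exact (Nat.Coprime.dvd_of_dvd_mul_right hd'k (hx.symm ▸ Dvd.intro _ rfl))
    subst dd
    have kk : k = k' := (Nat.eq_of_mul_eq_mul_left (by omega) hx).symm
    subst kk
    subst hw
    have haa : a = a' := by
      have : a * (1 - w) = a' * (1 - w) := by linear_combination happex - h2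
      exact mul_right_cancel₀ (sub_ne_zero.2 w1.symm) this
    subst haa
    have hcc : c = c' := add_right_cancel happex
    subst hcc
    refine ⟨rfl, rfl, ?_⟩
    rw [vtx_image k (by omega), vtx_image k (by omega)]
    apply Set.Subset.antisymm
    · rintro _ ⟨m, rfl⟩
      refine ⟨m - j + j', ?_⟩
      rw [sh, sh']; congr 1; ring
    · rintro _ ⟨m, rfl⟩
      refine ⟨m - j' + j, ?_⟩
      rw [sh, sh']; congr 1; ring
  · exfalso
    have hw := tri_key c c' a a' w w'⁻¹ n1 (inv_ne_zero n2) ha' (by simpa using w1) happex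
      (by rw [inv_inv]; exact h1) h2
    rw [hw, Complex.inv_im] at im1
    have : -w'.im / Complex.normSq w' ≤ 0 :=
      div_nonpos_of_nonpos_of_nonneg (by linarith) (Complex.normSq_nonneg _)
    linarith
end

section
/- Let S ⊆ ℂ be a finite set of n points and let k ≥ 3 be an integer. Then the number of subsets V ⊆ S that are vertex sets of regular k-gons is at most n(n−1)/k. -/
/-- `V` is the vertex set of a regular `k`-gon: there are `c z : ℂ` with `z ≠ 0`
such that `V = { c + z·exp(2πi·j/k) : j = 0, 1, …, k-1 }`. -/
def IsRegularGonVertexSet (k : ℕ) (V : Finset ℂ) : Prop :=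
  ∃ c z : ℂ, z ≠ 0 ∧
    (V : Set ℂ) = {x : ℂ | ∃ j : ℕ, j < k ∧
      x = c + z * Complex.exp (2 * Real.pi * Complex.I * j / k)}

lemma gon_char (k : ℕ) (hk : 3 ≤ k) (V : Finset ℂ) (h : IsRegularGonVertexSet k V) :
    ∃ c z : ℂ, z ≠ 0 ∧ ∀ x, x ∈ V ↔ (x - c) ^ k = z ^ k := by
  obtain ⟨c, z, hz, hV⟩ := h
  have hk0 : k ≠ 0 := by omega
  have : NeZero k := ⟨hk0⟩
  have hp := Complex.isPrimitiveRoot_exp k hk0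
  have he : ∀ j : ℕ, Complex.exp (2 * Real.pi * Complex.I * j / k)
      = Complex.exp (2 * Real.pi * Complex.I / k) ^ j := by
    intro j
    rw [← Complex.exp_nat_mul]
    congr 1
    ring
  refine ⟨c, z, hz, fun x => ?_⟩
  rw [← Finset.mem_coe, hV, Set.mem_setOf_eq]
  constructor
  · rintro ⟨j, _, rfl⟩
    rw [he, add_sub_cancel_left, mul_pow, ← pow_mul, mul_comm j k, pow_mul, hp.pow_eq_one]
    simp
  · intro h
    have h1 : ((x - c) / z) ^ k = 1 := by
      rw [div_pow, h, div_self (pow_ne_zero _ hz)]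
    obtain ⟨j, hj, hj'⟩ := hp.eq_pow_of_pow_eq_one h1
    refine ⟨j, hj, ?_⟩
    rw [he, hj']
    field_simp
    ring

open scoped Classical in
/-- In a set `S` of `n` points of the plane, the number of subsets that are
vertex sets of regular `k`-gons (`k ≥ 3`) is at most `n(n-1)/k`. -/
theorem stmt_7 (S : Finset ℂ) (k : ℕ) (hk : 3 ≤ k) :
    (((S.powerset.filter (fun V => IsRegularGonVertexSet k V)).card : ℝ))
      ≤ (S.card : ℝ) * ((S.card : ℝ) - 1) / k := by
  have hk0 : k ≠ 0 := by omega
  have hp := Complex.isPrimitiveRoot_exp k hk0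
  set w := Complex.exp (2 * Real.pi * Complex.I / k) with hw
  have hw1 : w - 1 ≠ 0 := sub_ne_zero.2 (hp.ne_one (by omega))
  have hw0 : w ≠ 0 := Complex.exp_ne_zero _
  have hwk : ∀ j : ℕ, (w ^ j) ^ k = 1 := by
    intro j
    rw [← pow_mul, mul_comm j k, pow_mul, hp.pow_eq_one, one_pow]
  have hex : ∀ V : Finset ℂ, ∃ c z : ℂ, IsRegularGonVertexSet k V →
      z ≠ 0 ∧ ∀ x, x ∈ V ↔ (x - c) ^ k = z ^ k := by
    intro V
    by_cases h : IsRegularGonVertexSet k V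
    · obtain ⟨c, z, h'⟩ := gon_char k hk V h
      exact ⟨c, z, fun _ => h'⟩
    · exact ⟨0, 0, fun h' => absurd h' h⟩
  choose c z hcz using hex
  set F := S.powerset.filter (fun V => IsRegularGonVertexSet k V) with hF
  have hmem : ∀ V, IsRegularGonVertexSet k V → ∀ j : ℕ, c V + z V * w ^ j ∈ V := by
    intro V hV j
    rw [(hcz V hV).2, add_sub_cancel_left, mul_pow, hwk, mul_one]
  have key : (F ×ˢ Finset.range k).card ≤ S.offDiag.card := by
    apply Finset.card_le_card_of_injOn
      (fun p => (c p.1 + z p.1 * w ^ p.2, c p.1 + z p.1 * w ^ (p.2 + 1)))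
    · rintro ⟨V, j⟩ h
      simp only [Finset.coe_product, Set.mem_prod, Finset.mem_coe, hF, Finset.mem_filter,
        Finset.mem_powerset] at h
      obtain ⟨⟨hVS, hV⟩, _⟩ := h
      simp only [Finset.mem_coe, Finset.mem_offDiag]
      refine ⟨hVS (hmem V hV _), hVS (hmem V hV _), fun e => ?_⟩
      have : z V * w ^ j * (w - 1) = 0 := by
        rw [pow_succ] at e
        linear_combination -e
      exact mul_ne_zero (mul_ne_zero (hcz V hV).1 (pow_ne_zero _ hw0)) hw1 this
    · rintro ⟨V, j⟩ h ⟨V', j'⟩ h' e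
      simp only [Finset.coe_product, Set.mem_prod, Finset.mem_coe, hF, Finset.mem_filter,
        Finset.mem_powerset, Finset.mem_range] at h h'
      obtain ⟨⟨_, hV⟩, hj⟩ := h
      obtain ⟨⟨_, hV'⟩, hj'⟩ := h'
      simp only [Prod.mk.injEq, pow_succ] at e
      obtain ⟨e1, e2⟩ := e
      have hu : z V * w ^ j = z V' * w ^ j' := by
        apply mul_right_cancel₀ hw1
        linear_combination e2 - e1
      have hc : c V = c V' := by linear_combination e1 - hu
      have hzk : z V ^ k = z V' ^ k := by
        have := congrArg (· ^ k) hu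
        simpa [mul_pow, hwk] using this
      have hVV : V = V' := by
        ext x
        rw [(hcz V hV).2, (hcz V' hV').2, hc, hzk]
      subst hVV
      have := hp.pow_inj hj hj' (mul_left_cancel₀ (hcz V hV).1 hu)
      rw [this]
  rw [Finset.card_product, Finset.card_range, Finset.offDiag_card] at key
  have hkpos : (0 : ℝ) < k := by positivity
  rw [le_div_iff₀ hkpos]
  have h2 : F.card * k + S.card ≤ S.card * S.card := by
    have : S.card ≤ S.card * S.card := Nat.le_mul_self _
    omega
  have h3 : (F.card : ℝ) * k + S.card ≤ S.card * S.card := by exact_mod_cast h2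
  linarith
end

section
/- Let k ≥ 4 be an integer, c ∈ ℂ, z ∈ ℂ with z ≠ 0, and let v_j = c + z·exp(2πi·j/k) for j ∈ ℤ (indices taken modulo k). Then the number of distinct 3-element subsets of { v_0, …, v_{k−1} } of the form { v_{j−d}, v_j, v_{j+d} } with 0 ≤ j ≤ k−1, 1 ≤ d ≤ ⌈k/2⌉ − 1 and gcd(d, k) = 1, equals exactly k·φ(k)/2, where φ is Euler's totient function. -/
theorem vtx_eq_iff (k : ℕ) (hk : 4 ≤ k) (c z : ℂ) (hz : z ≠ 0) (a b : ℤ) :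
    vtx k c z a = vtx k c z b ↔ (a : ZMod k) = (b : ZMod k) := by
  have hk0 : (k : ℂ) ≠ 0 := by
    have : k ≠ 0 := by omega
    exact_mod_cast this
  have h2 : (2 * Real.pi * Complex.I : ℂ) ≠ 0 := Complex.two_pi_I_ne_zero
  unfold vtx
  rw [add_right_inj, mul_right_inj' hz, Complex.exp_eq_exp_iff_exists_int, eq_comm (a := (a : ZMod k)),
    ZMod.intCast_eq_intCast_iff_dvd_sub]
  constructor
  · rintro ⟨n, hn⟩
    refine ⟨n, ?_⟩
    have h3 : (2 * Real.pi * Complex.I : ℂ) * a = (2 * Real.pi * Complex.I : ℂ) * (b + k * n) := by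
      field_simp at hn
      linear_combination (2 * Real.pi * Complex.I : ℂ) * hn
    have h4 := mul_left_cancel₀ h2 h3
    have h5 : a = b + k * n := by exact_mod_cast h4
    linarith
  · rintro ⟨n, hn⟩
    refine ⟨n, ?_⟩
    have h5 : a = b + k * n := by linarith
    subst h5
    push_cast
    field_simp

theorem ring_aux {R : Type*} [CommRing R] (j j' d d' : R)
    (h1 : d ≠ 0) (h2 : 2 * d ≠ 0) (h3 : 3 * d ≠ 0) (hs : d + d' ≠ 0)
    (ha : j - d = j' - d' ∨ j - d = j' ∨ j - d = j' + d')
    (hb : j = j' - d' ∨ j = j' ∨ j = j' + d')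
    (hc : j + d = j' - d' ∨ j + d = j' ∨ j + d = j' + d')
    (hd : j' = j - d ∨ j' = j ∨ j' = j + d) : j = j' ∧ d = d' := by
  rcases hd with hd | hd | hd <;> subst hd
  · exfalso
    rcases hb with hb | hb | hb <;> rcases hc with hc | hc | hc <;> grind
  · refine ⟨rfl, ?_⟩
    rcases hc with hc | hc | hc <;> grind
  · exfalso
    rcases ha with ha | ha | ha <;> rcases hb with hb | hb | hb <;> grind

theorem ceil_aux (k d : ℕ) (hk : 4 ≤ k) :
    d ∈ Finset.Icc 1 (⌈(k : ℚ) / 2⌉₊ - 1) ↔ 1 ≤ d ∧ 2 * d < k := by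
  rw [Finset.mem_Icc]
  have h : d < ⌈(k : ℚ) / 2⌉₊ ↔ 2 * d < k := by
    rw [Nat.lt_ceil, lt_div_iff₀ (by norm_num)]
    constructor
    · intro h
      have : d * 2 < k := by exact_mod_cast h
      omega
    · intro h
      have : d * 2 < k := by omega
      exact_mod_cast this
  omega

theorem tot_aux (k : ℕ) (hk : 4 ≤ k) :
    2 * ((Finset.Icc 1 (⌈(k : ℚ) / 2⌉₊ - 1)).filter (fun d => Nat.gcd d k = 1)).card
      = Nat.totient k := by
  set A := (Finset.Icc 1 (⌈(k : ℚ) / 2⌉₊ - 1)).filter (fun d => Nat.gcd d k = 1) with hA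
  have memA : ∀ d, d ∈ A ↔ (1 ≤ d ∧ 2 * d < k) ∧ Nat.gcd d k = 1 := by
    intro d
    rw [hA, Finset.mem_filter, ceil_aux k d hk]
  have gs : ∀ d, d ≤ k → Nat.gcd (k - d) k = Nat.gcd d k := by
    intro d hd
    rw [Nat.gcd_comm, Nat.gcd_self_sub_right hd, Nat.gcd_comm]
  have hB : (A.image (fun d => k - d)).card = A.card := by
    apply Finset.card_image_of_injOn
    intro a ha b hb hab
    have ha' := (memA a).1 ha
    have hb' := (memA b).1 hb
    simp only at hab
    omega
  have hdis : Disjoint A (A.image (fun d => k - d)) := by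
    rw [Finset.disjoint_left]
    intro a ha hb
    obtain ⟨b, hb2, rfl⟩ := Finset.mem_image.1 hb
    have ha' := (memA _).1 ha
    have hb' := (memA b).1 hb2
    omega
  rw [Nat.totient_eq_card_coprime]
  have hU : (Finset.range k).filter (fun d => Nat.Coprime k d) = A ∪ A.image (fun d => k - d) := by
    ext d
    rw [Finset.mem_filter, Finset.mem_range, Finset.mem_union, Finset.mem_image, memA,
      Nat.coprime_comm, Nat.coprime_iff_gcd_eq_one]
    constructor
    · rintro ⟨hd, hg⟩
      have h0 : d ≠ 0 := by
        rintro rfl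
        simp at hg
        omega
      have h2 : 2 * d ≠ k := by
        intro h
        rw [← h, Nat.gcd_mul_left_right] at hg
        omega
      rcases lt_or_gt_of_ne h2 with h | h
      · exact Or.inl ⟨⟨by omega, h⟩, hg⟩
      · refine Or.inr ⟨k - d, (memA _).2 ⟨⟨by omega, by omega⟩, ?_⟩, by omega⟩
        rw [gs d hd.le, hg]
    · rintro (⟨⟨h1, h2⟩, h3⟩ | ⟨e, he, rfl⟩)
      · exact ⟨by omega, h3⟩
      · obtain ⟨⟨h1, h2⟩, h3⟩ := (memA e).1 he
        exact ⟨by omega, by rw [gs e (by omega), h3]⟩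
  rw [hU, Finset.card_union_of_disjoint hdis, hB]
  ring

theorem nat_ne_aux (k n : ℕ) (h0 : 0 < n) (h : n < k) : (n : ZMod k) ≠ 0 := by
  rw [Ne, ZMod.natCast_eq_zero_iff]
  exact Nat.not_dvd_of_pos_of_lt h0 h

theorem nat_inj_aux (k a b : ℕ) (ha : a < k) (hb : b < k) (h : (a : ZMod k) = b) : a = b := by
  rw [ZMod.natCast_eq_natCast_iff'] at h
  rwa [Nat.mod_eq_of_lt ha, Nat.mod_eq_of_lt hb] at h


open scoped Classical in
/-- For `k ≥ 4`, the number of distinct 3-element subsets of the vertex set of a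
regular `k`-gon of the form `{v_{j-d}, v_j, v_{j+d}}` with `0 ≤ j ≤ k-1`,
`1 ≤ d ≤ ⌈k/2⌉ - 1` and `gcd(d, k) = 1` (the special triangles) is exactly
`k·φ(k)/2`. -/
theorem stmt_10 (k : ℕ) (hk : 4 ≤ k) (c z : ℂ) (hz : z ≠ 0) :
    ((((Finset.range k) ×ˢ (Finset.Icc 1 (⌈(k : ℚ) / 2⌉₊ - 1))).filter
        (fun jd : ℕ × ℕ => Nat.gcd jd.2 k = 1)).image
      (fun jd : ℕ × ℕ =>
        ({vtx k c z ((jd.1 : ℤ) - (jd.2 : ℤ)), vtx k c z (jd.1 : ℤ),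
          vtx k c z ((jd.1 : ℤ) + (jd.2 : ℤ))} : Finset ℂ))).card
      = k * Nat.totient k / 2 := by
  rw [Finset.card_image_of_injOn]
  · have hp : ((Finset.range k) ×ˢ (Finset.Icc 1 (⌈(k : ℚ) / 2⌉₊ - 1))).filter
        (fun jd : ℕ × ℕ => Nat.gcd jd.2 k = 1) = (Finset.range k) ×ˢ
        ((Finset.Icc 1 (⌈(k : ℚ) / 2⌉₊ - 1)).filter (fun d => Nat.gcd d k = 1)) := by
      ext x
      simp only [Finset.mem_filter, Finset.mem_product]
      tauto
    rw [hp, Finset.card_product, Finset.card_range, ← tot_aux k hk, Nat.mul_left_comm,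
      Nat.mul_div_cancel_left _ (by norm_num)]
  · rintro ⟨j, d⟩ hx ⟨j', d'⟩ hy hxy
    rw [Finset.mem_coe, Finset.mem_filter, Finset.mem_product, ceil_aux k _ hk,
      Finset.mem_range] at hx hy
    obtain ⟨⟨hj, hd1, hd2⟩, hg⟩ := hx
    obtain ⟨⟨hj', hd1', hd2'⟩, hg'⟩ := hy
    simp only at hj hd1 hd2 hg hj' hd1' hd2' hg' hxy
    have key : ∀ x, _ := Finset.ext_iff.1 hxy
    simp only [Finset.mem_insert, Finset.mem_singleton] at key
    have ha := (key (vtx k c z ((j : ℤ) - (d : ℤ)))).1 (Or.inl rfl)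
    have hb := (key (vtx k c z (j : ℤ))).1 (Or.inr (Or.inl rfl))
    have hc := (key (vtx k c z ((j : ℤ) + (d : ℤ)))).1 (Or.inr (Or.inr rfl))
    have hd := (key (vtx k c z (j' : ℤ))).2 (Or.inr (Or.inl rfl))
    simp only [vtx_eq_iff k hk c z hz] at ha hb hc hd
    push_cast at ha hb hc hd
    have e1 := nat_ne_aux k d (by omega) (by omega)
    have e2 := nat_ne_aux k (2 * d) (by omega) (by omega)
    have e3 : ((3 * d : ℕ) : ZMod k) ≠ 0 := by
      rw [Ne, ZMod.natCast_eq_zero_iff]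
      intro h
      have h' : Nat.Coprime k d := by rw [Nat.coprime_comm]; exact hg
      have := Nat.le_of_dvd (by norm_num) (h'.dvd_of_dvd_mul_right h)
      omega
    have e4 := nat_ne_aux k (d + d') (by omega) (by omega)
    push_cast at e2 e3 e4
    obtain ⟨r1, r2⟩ := ring_aux _ _ _ _ e1 e2 e3 e4 ha hb hc hd
    rw [nat_inj_aux k j j' hj hj' r1, nat_inj_aux k d d' (by omega) (by omega) r2]
end
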